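/- arXiv:0907.2049 — 3 statements merged into one kernel-verified Lean document; each statement's English description precedes it below -/
import Mathlib

section
/- Let x_1,…,x_n and y_1,…,y_n be points on the circle. Then there exists an index i ∈ {1,…,n} such that ∑_{k=1}^n dist(x_i,x_k) ≤ ∑_{k=1}^n dist(x_i,y_k). (This is group strategyproofness of the Random Dictator mechanism on a circle.) -/
lemma rd_norm (u : ℝ) (h0 : 0 ≤ u) (h1 : u ≤ 1) :
    ‖((u : ℝ) : AddCircle (1 : ℝ))‖ = min u (1 - u) := by
  have h := UnitAddCircle.norm_eq (x := u)
  rw [abs_sub_round_eq_min] at h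
  refine h.trans ?_
  rcases h1.lt_or_eq with h1 | h1
  · rw [Int.fract_eq_self.2 ⟨h0, h1⟩]
  · subst h1; simp

/-- First-order conditions for a maximiser of a quadratic form on the simplex. -/
lemma rd_kkt {n : ℕ} (hn : 1 ≤ n) (D : Fin n → Fin n → ℝ) (hs : ∀ i j, D i j = D j i)
    (hz : ∀ i, D i i = 0) (hp : ∀ i j, 0 ≤ D i j) :
    ∃ w : Fin n → ℝ, (∀ i, 0 ≤ w i) ∧ ∑ i, w i = 1 ∧
      ∀ j, ∑ i, w i * D i j ≤ ∑ k, w k * ∑ i, w i * D i k := by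
  let Q : (Fin n → ℝ) → ℝ := fun w => ∑ k, w k * ∑ i, w i * D i k
  have hQ : Continuous Q := by unfold Q; fun_prop
  have hne : (stdSimplex ℝ (Fin n)).Nonempty := ⟨_, single_mem_stdSimplex ℝ (⟨0, hn⟩ : Fin n)⟩
  obtain ⟨w, ⟨hw0, hw1⟩, hmax⟩ :=
    (isCompact_stdSimplex ℝ (Fin n)).exists_isMaxOn hne hQ.continuousOn
  refine ⟨w, hw0, hw1, fun j => ?_⟩
  change _ ≤ Q w
  set F : ℝ := ∑ i, w i * D i j with hF
  have hQ0 : 0 ≤ Q w := Finset.sum_nonneg fun k _ => mul_nonneg (hw0 k)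
    (Finset.sum_nonneg fun i _ => mul_nonneg (hw0 i) (hp i k))
  have key : ∀ ε : ℝ, 0 ≤ ε → ε ≤ 1 →
      (1 - ε) ^ 2 * Q w + 2 * ε * (1 - ε) * F ≤ Q w := by
    intro ε h0 h1
    have hmem : (fun i => (1 - ε) * w i + ε * (Pi.single j 1 : Fin n → ℝ) i)
        ∈ stdSimplex ℝ (Fin n) := by
      have := (convex_stdSimplex ℝ (Fin n)) ⟨hw0, hw1⟩ (single_mem_stdSimplex ℝ j)
        (sub_nonneg.2 h1) h0 (by ring)
      convert this using 1
      ext i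
      simp
    have h := hmax hmem
    have e : Q (fun i => (1 - ε) * w i + ε * (Pi.single j 1 : Fin n → ℝ) i)
        = (1 - ε) ^ 2 * Q w + 2 * ε * (1 - ε) * F := by
      have e1 : ∀ k, ∑ i, ((1 - ε) * w i + ε * (Pi.single j 1 : Fin n → ℝ) i) * D i k
          = (1 - ε) * ∑ i, w i * D i k + ε * D j k := by
        intro k
        simp only [add_mul, Finset.sum_add_distrib, mul_assoc, ← Finset.mul_sum]
        simp [Pi.single_apply]
      have e2 : ∑ k, w k * D j k = F := Finset.sum_congr rfl fun k _ => by rw [hs j k]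
      simp only [Q, e1]
      have e3 : ∀ k, ((1 - ε) * w k + ε * (Pi.single j 1 : Fin n → ℝ) k) *
          ((1 - ε) * ∑ i, w i * D i k + ε * D j k)
          = (1 - ε) ^ 2 * (w k * ∑ i, w i * D i k) + ε * (1 - ε) * (w k * D j k)
            + (Pi.single j 1 : Fin n → ℝ) k *
              (ε * ((1 - ε) * ∑ i, w i * D i k + ε * D j k)) := fun k => by ring
      simp only [e3, Finset.sum_add_distrib, ← Finset.mul_sum, e2]
      have e4 : ∑ k, (Pi.single j 1 : Fin n → ℝ) k *
              (ε * ((1 - ε) * ∑ i, w i * D i k + ε * D j k)) = ε * ((1 - ε) * F) := by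
        simp [Pi.single_apply, hz, hF]
      rw [e4]; ring
    have h' : Q (fun i => (1 - ε) * w i + ε * (Pi.single j 1 : Fin n → ℝ) i) ≤ Q w := h
    rwa [e] at h'
  by_contra! hlt
  set g := F - Q w with hg
  have hgpos : 0 < g := sub_pos.2 hlt
  have hd : 0 < 2 * g + Q w := by linarith
  have hε : 0 < g / (2 * g + Q w) := by positivity
  have hε1 : g / (2 * g + Q w) ≤ 1 := by rw [div_le_one hd]; linarith
  have hk := key _ hε.le hε1
  have hm : g / (2 * g + Q w) * (2 * g + Q w) = g := div_mul_cancel₀ _ hd.ne'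
  set ε := g / (2 * g + Q w)
  have hFe : F = g + Q w := by rw [hg]; ring
  rw [hFe] at hk
  have : ε * (2 * g - ε * (2 * g + Q w)) ≤ 0 := by nlinarith
  rw [hm] at this
  nlinarith

lemma rd_min {n : ℕ} (x : Fin n → AddCircle (1 : ℝ)) (w : Fin n → ℝ) (hw0 : ∀ i, 0 ≤ w i)
    (hw1 : ∑ i, w i = 1) (c : ℝ) (hc : ∀ j, 0 < w j → c ≤ ∑ i, w i * dist (x i) (x j))
    (z : AddCircle (1 : ℝ)) : c ≤ ∑ i, w i * dist (x i) z := by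
  have ht : ∀ i, ∃ t : ℝ, 0 ≤ t ∧ t < 1 ∧ x i = z + (t : AddCircle (1 : ℝ)) := by
    intro i
    obtain ⟨r, hr⟩ := QuotientAddGroup.mk_surjective (x i - z)
    refine ⟨Int.fract r, Int.fract_nonneg r, Int.fract_lt_one r, ?_⟩
    have : ((Int.fract r : ℝ) : AddCircle (1 : ℝ)) = x i - z := by
      rw [← hr, Int.fract, AddCircle.coe_sub, sub_eq_self.2]
      exact (AddCircle.coe_eq_zero_iff (1 : ℝ)).2 ⟨⌊r⌋, by simp⟩
    rw [this]; abel
  choose t t0 t1 hx using ht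
  let S := Finset.univ.filter fun i => 0 < w i
  have hS : S.Nonempty := by
    by_contra hne
    rw [Finset.not_nonempty_iff_eq_empty, Finset.filter_eq_empty_iff] at hne
    have : ∑ i, w i = 0 := Finset.sum_eq_zero fun i hi => le_antisymm (not_lt.1 (hne hi)) (hw0 i)
    linarith
  obtain ⟨q, hqS, hq⟩ := S.exists_min_image t hS
  obtain ⟨p, hpS, hp⟩ := S.exists_max_image t hS
  have hcp := hc p (Finset.mem_filter.1 hpS).2
  have hcq := hc q (Finset.mem_filter.1 hqS).2
  have main : ∀ i, t q * (w i * dist (x i) (x p)) + (1 - t p) * (w i * dist (x i) (x q))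
      ≤ (t q + (1 - t p)) * (w i * dist (x i) z) := by
    intro i
    rcases (hw0 i).eq_or_lt with h | h
    · simp [← h]
    have hi : i ∈ S := by simp [S, h]
    have h1 := hq i hi
    have h2 := hp i hi
    have d0 : dist (x i) z = min (t i) (1 - t i) := by
      rw [dist_eq_norm, hx i, add_sub_cancel_left, rd_norm _ (t0 i) (t1 i).le]
    have d1 : dist (x i) (x q) = min (t i - t q) (1 - (t i - t q)) := by
      rw [dist_eq_norm, hx i, hx q, add_sub_add_left_eq_sub, ← AddCircle.coe_sub,
        rd_norm _ (by linarith) (by linarith [t0 q, t1 i])]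
    have d2 : dist (x i) (x p) = min (t p - t i) (1 - (t p - t i)) := by
      rw [dist_comm, dist_eq_norm, hx i, hx p, add_sub_add_left_eq_sub, ← AddCircle.coe_sub,
        rd_norm _ (by linarith) (by linarith [t0 i, t1 p])]
    have hb := t0 q
    have ha := t1 p
    have conc : t q * dist (x i) (x p) + (1 - t p) * dist (x i) (x q)
        ≤ (t q + (1 - t p)) * dist (x i) z := by
      rw [d0, d1, d2]
      have m1 := min_le_left (t p - t i) (1 - (t p - t i))
      have m2 := min_le_right (t p - t i) (1 - (t p - t i))
      have m3 := min_le_left (t i - t q) (1 - (t i - t q))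
      have m4 := min_le_right (t i - t q) (1 - (t i - t q))
      have l1 := mul_le_mul_of_nonneg_left m1 hb
      have l2 := mul_le_mul_of_nonneg_left m2 hb
      have l3 := mul_le_mul_of_nonneg_left m3 (sub_nonneg.2 ha.le)
      have l4 := mul_le_mul_of_nonneg_left m4 (sub_nonneg.2 ha.le)
      rcases min_choice (t i) (1 - t i) with e | e <;> rw [e] <;> nlinarith
    have := mul_le_mul_of_nonneg_left conc h.le
    linarith
  have hsum := Finset.sum_le_sum fun i (_ : i ∈ Finset.univ) => main i
  rw [Finset.sum_add_distrib, ← Finset.mul_sum, ← Finset.mul_sum, ← Finset.mul_sum] at hsum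
  have hb := t0 q
  have ha : 0 < 1 - t p := sub_pos.2 (t1 p)
  have l1 := mul_le_mul_of_nonneg_left hcp hb
  have l2 := mul_le_mul_of_nonneg_left hcq ha.le
  have hpos : 0 < t q + (1 - t p) := by linarith
  exact le_of_mul_le_mul_left (by linarith) hpos

/-- **Group strategyproofness of the Random Dictator mechanism on a circle.**
For points `x 1, …, x n` and `y 1, …, y n` on the circle `ℝ/ℤ` (circumference 1,
with the shorter-arc distance), there exists `i` with
`∑ k dist (x i) (x k) ≤ ∑ k dist (x i) (y k)`. -/
theorem random_dictator_gsp_circle {n : ℕ} (hn : 1 ≤ n)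
    (x y : Fin n → AddCircle (1 : ℝ)) :
    ∃ i : Fin n, ∑ k : Fin n, dist (x i) (x k) ≤ ∑ k : Fin n, dist (x i) (y k) := by
  obtain ⟨w, hw0, hw1, hk⟩ := rd_kkt hn (fun i j => dist (x i) (x j))
    (fun i j => dist_comm _ _) (fun i => dist_self _) (fun i j => dist_nonneg)
  set c := ∑ k, w k * ∑ i, w i * dist (x i) (x k) with hcdef
  have hc : ∀ j, 0 < w j → c ≤ ∑ i, w i * dist (x i) (x j) := by
    intro j hj
    by_contra! hlt
    have : ∑ k, w k * ∑ i, w i * dist (x i) (x k) < ∑ k, w k * c :=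
      Finset.sum_lt_sum (fun k _ => mul_le_mul_of_nonneg_left (hk k) (hw0 k))
        ⟨j, Finset.mem_univ j, mul_lt_mul_of_pos_left hlt hj⟩
    rw [← Finset.sum_mul, hw1, one_mul] at this
    exact lt_irrefl _ this
  by_contra! hcon
  obtain ⟨j, hj⟩ : ∃ j, 0 < w j := by
    by_contra! hne
    have : ∑ i, w i ≤ 0 := Finset.sum_nonpos fun i _ => hne i
    linarith
  have h1 : ∑ i, w i * ∑ k, dist (x i) (y k) < ∑ i, w i * ∑ k, dist (x i) (x k) :=
    Finset.sum_lt_sum (fun i _ => mul_le_mul_of_nonneg_left (hcon i).le (hw0 i))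
      ⟨j, Finset.mem_univ j, mul_lt_mul_of_pos_left (hcon j) hj⟩
  simp only [Finset.mul_sum] at h1
  rw [Finset.sum_comm, Finset.sum_comm (f := fun i k => w i * dist (x i) (x k))] at h1
  have h2 : ∑ k, ∑ i, w i * dist (x i) (x k) ≤ ∑ k, ∑ i, w i * dist (x i) (y k) :=
    Finset.sum_le_sum fun k _ => (hk k).trans (rd_min x w hw0 hw1 c hc (y k))
  linarith
end

section
/- Let n ≥ 2 and let x_1,…,x_n be pairwise distinct points on the circle such that no x_k is antipodal to any x_l. Let A be the set of nearly antipodal (unordered) pairs, and write |A| = 2s+1. Then for every point y on the circle, the number of pairs {j,k} ∈ A whose critical arc crit(x_j,x_k) contains y is at most s+1. -/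
/-- The antipodal point of `x` on the circle `ℝ/ℤ` of circumference 1. -/
noncomputable def antipode (x : AddCircle (1 : ℝ)) : AddCircle (1 : ℝ) :=
  x + ((1 / 2 : ℝ) : AddCircle (1 : ℝ))

/-- The closed short arc between `a` and `b` (for `a ≠ b` with `dist a b < 1/2`):
points `z` lying on a geodesic between `a` and `b`. -/
def closedArc (a b : AddCircle (1 : ℝ)) : Set (AddCircle (1 : ℝ)) :=
  {z | dist a z + dist z b = dist a b}

/-- The open short arc between `a` and `b`: the closed short arc minus its endpoints. -/
def openArc (a b : AddCircle (1 : ℝ)) : Set (AddCircle (1 : ℝ)) :=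
  closedArc a b \ {a, b}

/-- The pair `{i, j}` is nearly antipodal for the profile `x`: `i ≠ j`, no point of
the profile lies in the open short arc between `x i` and the antipode of `x j`, and
none lies in the open short arc between `x j` and the antipode of `x i`. -/
def NearlyAntipodal {n : ℕ} (x : Fin n → AddCircle (1 : ℝ)) (i j : Fin n) : Prop :=
  i ≠ j ∧ (∀ k, x k ∉ openArc (x i) (antipode (x j))) ∧
    (∀ k, x k ∉ openArc (x j) (antipode (x i)))

/-- The critical arc of the pair `(a, b)`: the complement of the closed short arc
between the antipodes of `a` and `b`. -/
def crit (a b : AddCircle (1 : ℝ)) : Set (AddCircle (1 : ℝ)) :=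
  (closedArc (antipode a) (antipode b))ᶜ

/-- Distance on `[0,1)` viewed as the circle. -/
noncomputable def cD (a b : ℝ) : ℝ := min |a - b| (1 - |a - b|)

/-- Position of the antipode. -/
noncomputable def cQ (a : ℝ) : ℝ := if a < 1 / 2 then a + 1 / 2 else a - 1 / 2

/-- Position modulo antipodes. -/
noncomputable def cT (a : ℝ) : ℝ := if a < 1 / 2 then a else a - 1 / 2

lemma norm_coe_circle (r : ℝ) (h1 : -1 ≤ r) (h2 : r ≤ 1) :
    ‖(r : AddCircle (1 : ℝ))‖ = min |r| (1 - |r|) := by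
  by_cases h : |r| ≤ 1 / 2
  · rw [(AddCircle.norm_coe_eq_abs_iff (1 : ℝ) one_ne_zero).2 (by simpa using h)]
    rw [min_eq_left]; linarith
  · push Not at h
    rcases le_total 0 r with hr | hr
    · rw [abs_of_nonneg hr] at *
      have : (r : AddCircle (1 : ℝ)) = ((r - 1 : ℝ) : AddCircle (1 : ℝ)) := by
        rw [AddCircle.coe_sub, AddCircle.coe_period, sub_zero]
      rw [this, (AddCircle.norm_coe_eq_abs_iff (1 : ℝ) one_ne_zero).2, abs_of_nonpos (by linarith),
        min_eq_right] <;> try linarith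
      rw [abs_of_nonpos (by linarith), abs_one]; linarith
    · rw [abs_of_nonpos hr] at *
      have : (r : AddCircle (1 : ℝ)) = ((r + 1 : ℝ) : AddCircle (1 : ℝ)) := by
        simp
      rw [this, (AddCircle.norm_coe_eq_abs_iff (1 : ℝ) one_ne_zero).2, abs_of_nonneg (by linarith),
        min_eq_right] <;> try linarith
      rw [abs_of_nonneg (by linarith), abs_one]; linarith

lemma dist_circle (y : AddCircle (1 : ℝ)) (a b : ℝ) (ha : 0 ≤ a) (ha' : a < 1)
    (hb : 0 ≤ b) (hb' : b < 1) :
    dist (y + (a : AddCircle (1 : ℝ))) (y + (b : AddCircle (1 : ℝ))) = cD a b := by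
  rw [dist_add_left, dist_eq_norm, ← AddCircle.coe_sub, norm_coe_circle _ (by linarith)
    (by linarith)]
  rfl

lemma antipode_pos (y : AddCircle (1 : ℝ)) (a : ℝ) :
    antipode (y + (a : AddCircle (1 : ℝ))) = y + ((cQ a : ℝ) : AddCircle (1 : ℝ)) := by
  unfold antipode cQ
  rw [add_assoc, ← AddCircle.coe_add]
  split_ifs
  · rfl
  · congr 1
    have : a + 1 / 2 = (a - 1 / 2) + 1 := by ring
    rw [this, AddCircle.coe_add]; simp

lemma cQ_mem {a : ℝ} (ha : 0 ≤ a) (ha' : a < 1) : 0 ≤ cQ a ∧ cQ a < 1 := by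
  unfold cQ; split_ifs <;> constructor <;> linarith

lemma cT_mem {a : ℝ} (ha : 0 ≤ a) (ha' : a < 1) : 0 ≤ cT a ∧ cT a < 1 / 2 := by
  unfold cT; split_ifs <;> constructor <;> linarith

lemma coe_inj_circle (y : AddCircle (1 : ℝ)) (a b : ℝ) (ha : 0 ≤ a) (ha' : a < 1)
    (hb : 0 ≤ b) (hb' : b < 1) :
    y + (a : AddCircle (1 : ℝ)) = y + (b : AddCircle (1 : ℝ)) ↔ a = b := by
  constructor
  · intro h
    have h1 := dist_circle y a b ha ha' hb hb'
    rw [h, dist_self] at h1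
    unfold cD at h1
    have h2 : |a - b| < 1 := by rw [abs_lt]; constructor <;> linarith
    rcases min_choice |a - b| (1 - |a - b|) with h3 | h3 <;> rw [h3] at h1
    · exact sub_eq_zero.1 (abs_eq_zero.1 h1.symm)
    · linarith
  · rintro rfl; rfl

/-- Real model of the open arc. -/
def cO (a b z : ℝ) : Prop := cD a z + cD z b = cD a b ∧ z ≠ a ∧ z ≠ b

lemma mem_openArc_pos (y : AddCircle (1 : ℝ)) (a b z : ℝ) (ha : 0 ≤ a) (ha' : a < 1)
    (hb : 0 ≤ b) (hb' : b < 1) (hz : 0 ≤ z) (hz' : z < 1) :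
    y + (z : AddCircle (1 : ℝ)) ∈ openArc (y + (a : AddCircle (1 : ℝ)))
      (y + (b : AddCircle (1 : ℝ))) ↔ cO a b z := by
  unfold openArc closedArc cO
  simp only [Set.mem_diff, Set.mem_setOf_eq, Set.mem_insert_iff, Set.mem_singleton_iff, not_or]
  rw [dist_circle y _ _ ha ha' hz hz', dist_circle y _ _ hz hz' hb hb',
    dist_circle y _ _ ha ha' hb hb', coe_inj_circle y _ _ hz hz' ha ha',
    coe_inj_circle y _ _ hz hz' hb hb']

lemma mem_crit_pos (y : AddCircle (1 : ℝ)) (a b : ℝ) (ha : 0 ≤ a) (ha' : a < 1)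
    (hb : 0 ≤ b) (hb' : b < 1) :
    y ∈ crit (y + (a : AddCircle (1 : ℝ))) (y + (b : AddCircle (1 : ℝ))) ↔
      cD (cQ a) 0 + cD 0 (cQ b) ≠ cD (cQ a) (cQ b) := by
  unfold crit closedArc
  rw [antipode_pos, antipode_pos]
  have hy : y = y + ((0 : ℝ) : AddCircle (1 : ℝ)) := by simp
  obtain ⟨h1, h2⟩ := cQ_mem ha ha'
  obtain ⟨h3, h4⟩ := cQ_mem hb hb'
  simp only [Set.mem_compl_iff, Set.mem_setOf_eq]
  nth_rw 2 [hy]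
  nth_rw 3 [hy]
  rw [dist_circle y _ _ h1 h2 le_rfl one_pos, dist_circle y _ _ le_rfl one_pos h3 h4,
    dist_circle y _ _ h1 h2 h3 h4]

/-- Explicit form of the circle distance when the points are ordered. -/
lemma cD_cases (a b : ℝ) (ha : 0 ≤ a) (ha' : a < 1) (hb : 0 ≤ b) (hb' : b < 1) :
    (a ≤ b ∧ b - a ≤ 1 / 2 ∧ cD a b = b - a) ∨
    (a ≤ b ∧ 1 / 2 < b - a ∧ cD a b = 1 - (b - a)) ∨
    (b < a ∧ a - b ≤ 1 / 2 ∧ cD a b = a - b) ∨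
    (b < a ∧ 1 / 2 < a - b ∧ cD a b = 1 - (a - b)) := by
  unfold cD
  rcases le_or_gt a b with h | h
  · rw [abs_of_nonpos (by linarith)]
    rcases le_or_gt (b - a) (1 / 2) with h2 | h2
    · left; refine ⟨h, h2, ?_⟩; rw [min_eq_left] <;> linarith
    · right; left; refine ⟨h, h2, ?_⟩; rw [min_eq_right] <;> linarith
  · rw [abs_of_pos (by linarith)]
    rcases le_or_gt (a - b) (1 / 2) with h2 | h2
    · right; right; left; refine ⟨h, h2, ?_⟩; rw [min_eq_left]; linarith
    · right; right; right; refine ⟨h, h2, ?_⟩; rw [min_eq_right]; linarith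

lemma cD_near {a b : ℝ} (h : a ≤ b) (h' : b ≤ a + 1 / 2) : cD a b = b - a := by
  unfold cD; rw [abs_of_nonpos (by linarith), min_eq_left] <;> linarith

lemma cD_far {a b : ℝ} (h : a ≤ b) (h' : a + 1 / 2 ≤ b) : cD a b = 1 - (b - a) := by
  unfold cD; rw [abs_of_nonpos (by linarith), min_eq_right] <;> linarith

lemma cD_comm (a b : ℝ) : cD a b = cD b a := by
  unfold cD; rw [abs_sub_comm]

lemma cO_comm {a b z : ℝ} : cO a b z ↔ cO b a z := by
  unfold cO; rw [cD_comm a z, cD_comm z b, cD_comm a b, add_comm]; tauto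

/-- A short arc not crossing 0. -/
lemma cO_near {a b z : ℝ} (h : a < b) (h' : b < a + 1 / 2) (hz : 0 ≤ z) (hz' : z < 1)
    (ha : 0 ≤ a) (hb : b < 1) : cO a b z ↔ a < z ∧ z < b := by
  unfold cO
  rw [cD_near h.le h'.le]
  constructor
  · rintro ⟨h1, h2, h3⟩
    rcases cD_cases a z ha (by linarith) hz hz' with H | H | H | H <;>
    rcases cD_cases z b hz hz' (by linarith) hb with G | G | G | G <;>
    first
      | (exfalso; linarith)
      | exact ⟨lt_of_le_of_ne (by linarith) (Ne.symm h2), lt_of_le_of_ne (by linarith) h3⟩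
  · rintro ⟨h1, h2⟩
    rw [cD_near h1.le (by linarith), cD_near h2.le (by linarith)]
    exact ⟨by ring, h1.ne', h2.ne⟩

/-- A short arc crossing 0. -/
lemma cO_far {a b z : ℝ} (h : a < b) (h' : a + 1 / 2 < b) (hz : 0 ≤ z) (hz' : z < 1)
    (ha : 0 ≤ a) (hb : b < 1) : cO a b z ↔ z < a ∨ b < z := by
  unfold cO
  rw [cD_far h.le h'.le]
  constructor
  · rintro ⟨h1, h2, h3⟩
    rcases lt_or_gt_of_ne h2 with h2 | h2
    · exact Or.inl h2
    rcases lt_or_gt_of_ne h3 with h3 | h3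
    · exfalso
      rcases cD_cases a z ha (by linarith) hz hz' with H | H | H | H <;>
      rcases cD_cases z b hz hz' (by linarith) hb with G | G | G | G <;> linarith
    · exact Or.inr h3
  · rintro (h1 | h1)
    · rw [cD_comm a z, cD_near h1.le (by linarith), cD_far (by linarith) (by linarith)]
      exact ⟨by ring, h1.ne, by linarith⟩
    · rw [cD_comm z b, cD_far (b := z) (by linarith) (by linarith), cD_near h1.le (by linarith)]
      exact ⟨by ring, by linarith, h1.ne'⟩

/-- Real model of near antipodality. -/
def cNA {n : ℕ} (p : Fin n → ℝ) (i j : Fin n) : Prop :=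
  i ≠ j ∧ (∀ k, ¬ cO (p i) (cQ (p j)) (p k)) ∧ (∀ k, ¬ cO (p j) (cQ (p i)) (p k))

/-- Real model of membership of the base point in the critical arc. -/
def cC (a b : ℝ) : Prop := cD (cQ a) 0 + cD 0 (cQ b) ≠ cD (cQ a) (cQ b)

lemma cNA_comm {n : ℕ} {p : Fin n → ℝ} {i j : Fin n} : cNA p i j ↔ cNA p j i := by
  unfold cNA; rw [ne_comm]; tauto

lemma cC_comm {a b : ℝ} : cC a b ↔ cC b a := by
  unfold cC
  rw [cD_comm (cQ a) 0, cD_comm 0 (cQ b), cD_comm (cQ a), add_comm]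

lemma na_forward {n : ℕ} (p : Fin n → ℝ) (hp : ∀ k, 0 ≤ p k ∧ p k < 1) (i j : Fin n)
    (ht : cT (p i) < cT (p j)) (hna : cNA p i j) (hc : cC (p i) (p j)) :
    ((∀ k, ¬ (cT (p i) < cT (p k) ∧ cT (p k) < cT (p j))) ∧ p i < 1 / 2 ∧ ¬ p j < 1 / 2) ∨
    ((∀ k, cT (p i) ≤ cT (p k) ∧ cT (p k) ≤ cT (p j)) ∧ (p i < 1 / 2 ↔ p j < 1 / 2)) := by
  obtain ⟨-, h1, h2⟩ := hna
  obtain ⟨hi, hi'⟩ := hp i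
  obtain ⟨hj, hj'⟩ := hp j
  by_cases si : p i < 1 / 2 <;> by_cases sj : p j < 1 / 2
  · right
    refine ⟨fun k => ?_, by tauto⟩
    obtain ⟨hk, hk'⟩ := hp k
    have h1 := h1 k
    have h2 := h2 k
    simp only [cT, cQ, si, sj, if_true] at ht h1 h2 ⊢
    rw [cO_far (by linarith) (by linarith) hk hk' hi (by linarith)] at h1
    rw [cO_near (by linarith) (by linarith) hk hk' hj (by linarith)] at h2
    push Not at h1 h2
    split_ifs with sk
    · exact ⟨h1.1, by by_contra hh; push Not at hh; have := h2 hh; linarith⟩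
    · exact ⟨by have := h2 (by linarith); linarith, by linarith⟩
  · left
    refine ⟨fun k => ?_, si, sj⟩
    obtain ⟨hk, hk'⟩ := hp k
    have h1 := h1 k
    have h2 := h2 k
    simp only [cT, cQ, si, sj, if_true, if_false] at ht h1 h2 ⊢
    rw [cO_near (by linarith) (by linarith) hk hk' hi (by linarith)] at h1
    rw [cO_comm, cO_near (by linarith) (by linarith) hk hk' (by linarith) (by linarith)] at h2
    push Not at h1 h2
    split_ifs with sk
    · rintro ⟨a, b⟩; linarith [h1 a]
    · rintro ⟨a, b⟩; linarith [h2 (by linarith)]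
  · exfalso
    apply hc
    simp only [cT, cQ, si, sj, if_true, if_false] at ht h1 h2 ⊢
    rw [cD_comm (p i - 1 / 2) 0, cD_near (by linarith) (by linarith),
      cD_far (by linarith) (by linarith), cD_far (by linarith) (by linarith)]
    ring
  · right
    refine ⟨fun k => ?_, by tauto⟩
    obtain ⟨hk, hk'⟩ := hp k
    have h1 := h1 k
    have h2 := h2 k
    simp only [cT, cQ, si, sj, if_false] at ht h1 h2 ⊢
    rw [cO_comm, cO_near (by linarith) (by linarith) hk hk' (by linarith) (by linarith)] at h1
    rw [cO_comm, cO_far (by linarith) (by linarith) hk hk' (by linarith) (by linarith)] at h2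
    push Not at h1 h2
    split_ifs with sk
    · exact ⟨by linarith [h2.1], by by_contra hh; push Not at hh; have := h1 hh; linarith⟩
    · exact ⟨by have := h1 (by linarith); linarith, by linarith [h2.2]⟩

lemma na_backward {n : ℕ} (p : Fin n → ℝ) (hp : ∀ k, 0 ≤ p k ∧ p k < 1) (i j : Fin n)
    (ht : cT (p i) < cT (p j)) (h : ∀ k, ¬ (cT (p i) < cT (p k) ∧ cT (p k) < cT (p j)))
    (si : ¬ p i < 1 / 2) (sj : p j < 1 / 2) :
    cNA p i j ∧ ¬ cC (p i) (p j) := by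
  obtain ⟨hi, hi'⟩ := hp i
  obtain ⟨hj, hj'⟩ := hp j
  refine ⟨⟨by rintro rfl; exact lt_irrefl _ ht, fun k => ?_, fun k => ?_⟩, ?_⟩
  · obtain ⟨hk, hk'⟩ := hp k
    have h := h k
    simp only [cT, cQ, si, sj, if_true, if_false] at ht h ⊢
    rw [cO_near (by linarith) (by linarith) hk hk' (by linarith) (by linarith)]
    rintro ⟨a, b⟩
    rw [if_neg (by linarith)] at h
    exact h ⟨by linarith, by linarith⟩
  · obtain ⟨hk, hk'⟩ := hp k
    have h := h k
    simp only [cT, cQ, si, sj, if_true, if_false] at ht h ⊢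
    rw [cO_comm, cO_near (by linarith) (by linarith) hk hk' (by linarith) (by linarith)]
    rintro ⟨a, b⟩
    rw [if_pos (by linarith)] at h
    exact h ⟨by linarith, by linarith⟩
  · unfold cC
    push Not
    simp only [cT, cQ, si, sj, if_true, if_false] at ht ⊢
    rw [cD_comm (p i - 1 / 2) 0, cD_near (by linarith) (by linarith),
      cD_far (by linarith) (by linarith), cD_far (by linarith) (by linarith)]
    ring

open Classical in
lemma count_changes (f : ℕ → Prop) (m : ℕ) :
    ((Finset.range m).filter (fun k => f k ∧ ¬ f (k + 1))).card + (if f m then 1 else 0)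
    = ((Finset.range m).filter (fun k => ¬ f k ∧ f (k + 1))).card + (if f 0 then 1 else 0) := by
  induction m with
  | zero => simp
  | succ m ih =>
    rw [Finset.range_add_one, Finset.filter_insert, Finset.filter_insert]
    by_cases h1 : f m <;> by_cases h2 : f (m + 1) <;> simp [h1, h2] at ih ⊢ <;> omega

open Classical in
lemma real_count {m : ℕ} (p : Fin (m + 1) → ℝ) (hp : ∀ k, 0 ≤ p k ∧ p k < 1)
    (hinj : Function.Injective (fun k => cT (p k))) :
    ((Finset.univ : Finset (Fin (m + 1) × Fin (m + 1))).filter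
      (fun q => (q.1 < q.2 ∧ cNA p q.1 q.2) ∧ cC (p q.1) (p q.2))).card ≤
    ((Finset.univ : Finset (Fin (m + 1) × Fin (m + 1))).filter
      (fun q => (q.1 < q.2 ∧ cNA p q.1 q.2) ∧ ¬ cC (p q.1) (p q.2))).card + 1 := by
  set t : Fin (m + 1) → ℝ := fun k => cT (p k) with ht
  set e := Tuple.sort t with he
  have hmono : StrictMono (t ∘ e) :=
    (Tuple.monotone_sort t).strictMono_of_injective (hinj.comp e.injective)
  set E : ℕ → Fin (m + 1) := fun k => e (Fin.ofNat (m + 1) k) with hE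
  have hlt : ∀ k l, k ≤ m → l ≤ m → (t (E k) < t (E l) ↔ k < l) := by
    intro k l hk hl
    rw [show t (E k) < t (E l) ↔ _ from hmono.lt_iff_lt, Fin.lt_def]
    simp [Fin.ofNat, Nat.mod_eq_of_lt (Nat.lt_succ_of_le hk),
      Nat.mod_eq_of_lt (Nat.lt_succ_of_le hl)]
  have hEinj : ∀ k l, k ≤ m → l ≤ m → E k = E l → k = l := by
    intro k l hk hl h
    have h1 := hlt k l hk hl
    have h2 := hlt l k hl hk
    rw [h] at h1 h2
    simp at h1 h2
    omega
  have hsurj : ∀ i, ∃ k, k ≤ m ∧ E k = i := by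
    intro i
    refine ⟨(e.symm i).val, by omega, ?_⟩
    simp [hE]
  set f : ℕ → Prop := fun k => p (E k) < 1 / 2 with hf
  set g : Fin (m + 1) → Fin (m + 1) → Fin (m + 1) × Fin (m + 1) :=
    fun a b => (min a b, max a b) with hg
  have hcnt := count_changes f m
  set a := (Finset.range m).filter (fun k => f k ∧ ¬ f (k + 1)) with ha
  set b := (Finset.range m).filter (fun k => ¬ f k ∧ f (k + 1)) with hb
  -- key upper bound
  have key : ∀ i j, t i < t j → cNA p i j → cC (p i) (p j) →
      (∃ k ∈ a, E k = i ∧ E (k + 1) = j) ∨ ((f 0 ↔ f m) ∧ i = E 0 ∧ j = E m) := by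
    intro i j hij h1 h2
    obtain ⟨k, hk, rfl⟩ := hsurj i
    obtain ⟨l, hl, rfl⟩ := hsurj j
    have hkl := (hlt k l hk hl).1 hij
    rcases na_forward p hp _ _ hij h1 h2 with ⟨h3, h4, h5⟩ | ⟨h3, h4⟩
    · left
      have : l = k + 1 := by
        by_contra hne
        exact h3 (E (k + 1)) ⟨(hlt k (k + 1) hk (by omega)).2 (by omega),
          (hlt (k + 1) l (by omega) hl).2 (by omega)⟩
      subst this
      exact ⟨k, by simp only [ha, Finset.mem_filter, Finset.mem_range]; exact ⟨by omega, h4, h5⟩,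
        rfl, rfl⟩
    · right
      have hk0 : k = 0 := by
        by_contra hne
        exact absurd ((hlt 0 k (by omega) hk).2 (by omega)) (not_lt.2 (h3 (E 0)).1)
      have hlm : l = m := by
        by_contra hne
        exact absurd ((hlt l m hl le_rfl).2 (by omega)) (not_lt.2 (h3 (E m)).2)
      subst hk0 hlm
      exact ⟨h4, rfl, rfl⟩
  have upper : ((Finset.univ : Finset (Fin (m + 1) × Fin (m + 1))).filter
      (fun q => (q.1 < q.2 ∧ cNA p q.1 q.2) ∧ cC (p q.1) (p q.2))).card ≤
      a.card + (if (f 0 ↔ f m) then 1 else 0) := by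
    have hsub : (Finset.univ : Finset (Fin (m + 1) × Fin (m + 1))).filter
      (fun q => (q.1 < q.2 ∧ cNA p q.1 q.2) ∧ cC (p q.1) (p q.2)) ⊆
      a.image (fun k => g (E k) (E (k + 1))) ∪
        (if (f 0 ↔ f m) then {g (E 0) (E m)} else ∅) := by
      rintro ⟨i, j⟩ hq
      simp only [Finset.mem_filter, Finset.mem_univ, true_and] at hq
      obtain ⟨⟨hij, h1⟩, h2⟩ := hq
      have hne : t i ≠ t j := fun h => hij.ne (hinj h)
      rcases lt_or_gt_of_ne hne with h | h
      · have hgi : g i j = (i, j) := by simp [hg, hij.le]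
        rcases key i j h h1 h2 with ⟨k, hk, rfl, rfl⟩ | ⟨hw, rfl, rfl⟩
        · exact Finset.mem_union_left _ (Finset.mem_image.2 ⟨k, hk, hgi⟩)
        · apply Finset.mem_union_right
          rw [if_pos hw, hgi]; simp
      · have hgi : g j i = (i, j) := by simp [hg, hij.le]
        rcases key j i h (cNA_comm.1 h1) (cC_comm.1 h2) with ⟨k, hk, rfl, rfl⟩ | ⟨hw, rfl, rfl⟩
        · exact Finset.mem_union_left _ (Finset.mem_image.2 ⟨k, hk, hgi⟩)
        · apply Finset.mem_union_right
          rw [if_pos hw, hgi]; simp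
    refine (Finset.card_le_card hsub).trans ((Finset.card_union_le _ _).trans ?_)
    refine add_le_add Finset.card_image_le ?_
    split_ifs <;> simp
  have lower : b.card ≤ ((Finset.univ : Finset (Fin (m + 1) × Fin (m + 1))).filter
      (fun q => (q.1 < q.2 ∧ cNA p q.1 q.2) ∧ ¬ cC (p q.1) (p q.2))).card := by
    apply Finset.card_le_card_of_injOn (fun k => g (E k) (E (k + 1)))
    · intro k hk
      simp only [hb, Finset.coe_filter, Finset.mem_range, Set.mem_setOf_eq] at hk
      obtain ⟨hk, h1, h2⟩ := hk
      have hlt' := (hlt k (k + 1) (by omega) (by omega)).2 (by omega)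
      have hbk := na_backward p hp (E k) (E (k + 1)) hlt' (by
        intro l
        obtain ⟨l, hl, rfl⟩ := hsurj l
        rintro ⟨h3, h4⟩
        have h3 := (hlt k l (by omega) hl).1 h3
        have h4 := (hlt l (k + 1) hl (by omega)).1 h4
        omega) h1 h2
      have hne : E k ≠ E (k + 1) := fun h => by
        have := hEinj k (k + 1) (by omega) (by omega) h
        omega
      simp only [Finset.coe_filter, Finset.mem_univ, true_and, Set.mem_setOf_eq, hg]
      rcases lt_or_gt_of_ne hne with h | h
      · rw [min_eq_left h.le, max_eq_right h.le]
        exact ⟨⟨h, hbk.1⟩, hbk.2⟩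
      · rw [min_eq_right h.le, max_eq_left h.le]
        exact ⟨⟨h, cNA_comm.1 hbk.1⟩, fun hh => hbk.2 (cC_comm.1 hh)⟩
    · intro k hk l hl hkl
      simp only [hb, Finset.coe_filter, Finset.mem_range, Set.mem_setOf_eq] at hk hl
      have hkl' : (E k = E l ∧ E (k + 1) = E (l + 1)) ∨ (E k = E (l + 1) ∧ E (k + 1) = E l) := by
        simp only [hg, Prod.mk.injEq] at hkl
        obtain ⟨h1, h2⟩ := hkl
        rcases le_total (E k) (E (k + 1)) with h3 | h3 <;>
        rcases le_total (E l) (E (l + 1)) with h4 | h4 <;>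
        simp only [min_eq_left, min_eq_right, max_eq_left, max_eq_right, h3, h4] at h1 h2 <;>
        tauto
      rcases hkl' with ⟨h1, -⟩ | ⟨h1, h2⟩
      · exact hEinj k l (by omega) (by omega) h1
      · have := hEinj _ _ (by omega) (by omega) h1
        have := hEinj _ _ (by omega) (by omega) h2
        omega
  by_cases h0 : f 0 <;> by_cases hm : f m <;> simp [h0, hm] at hcnt upper <;> omega

/-- **Lemma (counting critical arcs at arbitrary points).** For `n ≥ 2` pairwise distinct
points `x 1, …, x n` on the circle, no two of which are antipodal, if the number of nearly
antipodal (unordered) pairs is `2s + 1`, then every point `y` of the circle lies in the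
critical arc of at most `s + 1` of these pairs. -/
theorem crit_count_le {n : ℕ} (hn : 2 ≤ n) (x : Fin n → AddCircle (1 : ℝ))
    (hinj : Function.Injective x)
    (hanti : ∀ k l : Fin n, x k ≠ antipode (x l))
    (s : ℕ)
    (hA : {p : Fin n × Fin n | p.1 < p.2 ∧ NearlyAntipodal x p.1 p.2}.ncard = 2 * s + 1) :
    ∀ y : AddCircle (1 : ℝ),
      {p : Fin n × Fin n |
          (p.1 < p.2 ∧ NearlyAntipodal x p.1 p.2) ∧ y ∈ crit (x p.1) (x p.2)}.ncard
        ≤ s + 1 := by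
  classical
  intro y
  obtain ⟨m, rfl⟩ : ∃ m, n = m + 1 := ⟨n - 1, by omega⟩
  have hex : ∀ k, ∃ r : ℝ, (0 ≤ r ∧ r < 1) ∧ x k = y + (r : AddCircle (1 : ℝ)) := by
    intro k
    haveI : Fact ((0 : ℝ) < 1) := ⟨one_pos⟩
    refine ⟨(AddCircle.equivIco (1 : ℝ) 0 (x k - y) : ℝ), ?_, ?_⟩
    · have := (AddCircle.equivIco (1 : ℝ) 0 (x k - y)).2
      simpa using this
    · rw [AddCircle.coe_equivIco]; abel
  choose p hp hx using hex
  have hNA : ∀ i j, NearlyAntipodal x i j ↔ cNA p i j := by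
    intro i j
    unfold NearlyAntipodal cNA
    have hi := cQ_mem (hp i).1 (hp i).2
    have hj := cQ_mem (hp j).1 (hp j).2
    simp only [hx, antipode_pos]
    simp only [mem_openArc_pos y _ _ _ (hp i).1 (hp i).2 hj.1 hj.2 (hp _).1 (hp _).2,
      mem_openArc_pos y _ _ _ (hp j).1 (hp j).2 hi.1 hi.2 (hp _).1 (hp _).2]
  have hC : ∀ i j, y ∈ crit (x i) (x j) ↔ cC (p i) (p j) := by
    intro i j
    rw [hx i, hx j, mem_crit_pos y _ _ (hp i).1 (hp i).2 (hp j).1 (hp j).2]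
    rfl
  have htinj : Function.Injective (fun k => cT (p k)) := by
    intro i j hij
    simp only [cT] at hij
    have h1 : p i ≠ cQ (p j) := by
      intro h
      apply hanti i j
      rw [hx i, hx j, antipode_pos, h]
    have h2 : p i = p j := by
      unfold cQ at h1
      split_ifs at hij h1
      · exact hij
      · exact absurd (by linarith) h1
      · exact absurd (by linarith) h1
      · linarith
    apply hinj
    rw [hx i, hx j, h2]
  have hmain := real_count p hp htinj
  simp only [hNA, hC] at hA ⊢
  have e1 : {q : Fin (m + 1) × Fin (m + 1) | q.1 < q.2 ∧ cNA p q.1 q.2} =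
    ((Finset.univ.filter (fun q : Fin (m + 1) × Fin (m + 1) =>
      q.1 < q.2 ∧ cNA p q.1 q.2) : Finset _) : Set (Fin (m + 1) × Fin (m + 1))) := by
    ext; simp
  have e2 : {q : Fin (m + 1) × Fin (m + 1) | (q.1 < q.2 ∧ cNA p q.1 q.2) ∧ cC (p q.1) (p q.2)} =
    ((Finset.univ.filter (fun q : Fin (m + 1) × Fin (m + 1) =>
      (q.1 < q.2 ∧ cNA p q.1 q.2) ∧ cC (p q.1) (p q.2)) : Finset _) :
        Set (Fin (m + 1) × Fin (m + 1))) := by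
    ext; simp
  rw [e1, Set.ncard_coe_finset] at hA
  rw [e2, Set.ncard_coe_finset]
  have hsum := Finset.card_filter_add_card_filter_not
    (s := Finset.univ.filter (fun q : Fin (m + 1) × Fin (m + 1) => q.1 < q.2 ∧ cNA p q.1 q.2))
    (fun q => cC (p q.1) (p q.2))
  rw [Finset.filter_filter, Finset.filter_filter] at hsum
  omega
end

section
/- Let n ≥ 2 and let t_0 ≤ t_1 ≤ … ≤ t_{n−1} be real numbers with t_{n−1} ≤ t_0 + 1. Set α = t_0 + 1 − t_{n−1}, and assume α ≤ 1/2 and t_{i+1} − t_i ≤ α for every i < n−1 (so α is the longest arc between two adjacent agents on the circle, and the agents are not contained in one open semicircle). Then: (a) for every point y of AddCircle 1 there exists i with dist(y, t̄_i) ≥ (1−α)/2; and (b) for the point c = ((t_0 + t_{n−1})/2)‾ (the center of the arc of the antipodal points of the extreme agents, antipodal to the center of the longest gap), dist(c, t̄_i) ≤ (1−α)/2 for every i. Hence the optimal maximum cost equals (1−α)/2. -/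
/-- **Optimal maximum cost on the circle when the agents do not lie on one open
semicircle.** Let `n + 1 ≥ 2` agents be at the points `t 0 ≤ t 1 ≤ ⋯ ≤ t n` (as points
of the circle `ℝ/ℤ` of circumference 1), with `t n ≤ t 0 + 1`. Let
`α = t 0 + 1 - t n` be the length of the longest gap between adjacent agents, i.e.
`α ≤ 1/2` and every gap `t (i+1) - t i ≤ α`. Then:
(a) every location `y` is at distance at least `(1 - α)/2` from some agent; and
(b) the point `c = (t 0 + t n)/2` (the antipode of the center of the longest gap) is
at distance at most `(1 - α)/2` from every agent.
Hence the optimal maximum cost is exactly `(1 - α)/2`. -/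
theorem circle_max_cost_optimum {n : ℕ} (hn : 1 ≤ n) (t : Fin (n + 1) → ℝ)
    (hmono : Monotone t) (hspan : t (Fin.last n) ≤ t 0 + 1)
    (α : ℝ) (hα : α = t 0 + 1 - t (Fin.last n)) (hhalf : α ≤ 1/2)
    (hgap : ∀ i : Fin n, t i.succ - t i.castSucc ≤ α) :
    (∀ y : AddCircle (1 : ℝ),
        ∃ i : Fin (n + 1), (1 - α) / 2 ≤ dist y ((t i : ℝ) : AddCircle (1 : ℝ))) ∧
    (∀ i : Fin (n + 1),
        dist (((t 0 + t (Fin.last n)) / 2 : ℝ) : AddCircle (1 : ℝ))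
          ((t i : ℝ) : AddCircle (1 : ℝ)) ≤ (1 - α) / 2) := by
  have hle : ∀ x : ℝ, ‖(x : AddCircle (1 : ℝ))‖ ≤ |x| := fun x => by
    rw [AddCircle.norm_eq]
    simpa using round_le x 0
  refine ⟨fun y => ?_, fun i => ?_⟩
  · haveI : Fact ((0 : ℝ) < 1) := ⟨one_pos⟩
    obtain ⟨z, hz, hzy⟩ : ∃ z ∈ Set.Ico (t 0) (t 0 + 1),
        (z : AddCircle (1 : ℝ)) = y + ((1 / 2 : ℝ) : AddCircle (1 : ℝ)) := by
      have h := AddCircle.coe_image_Ico_eq (1 : ℝ) (t 0)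
      have h2 : y + ((1 / 2 : ℝ) : AddCircle (1 : ℝ)) ∈ (Set.univ : Set (AddCircle (1 : ℝ))) :=
        Set.mem_univ _
      rw [← h] at h2
      exact h2
    have hyz : dist y (z : AddCircle (1 : ℝ)) = 1 / 2 := by
      rw [hzy, dist_eq_norm, sub_add_cancel_left, norm_neg, AddCircle.norm_half_period_eq]
      simp
    by_contra! hcon
    have hfar : ∀ i, α / 2 < dist (z : AddCircle (1 : ℝ)) ((t i : ℝ) : AddCircle (1 : ℝ)) := by
      intro i
      have h1 := hcon i
      have h2 := dist_triangle y ((t i : ℝ) : AddCircle (1 : ℝ)) (z : AddCircle (1 : ℝ))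
      rw [dist_comm ((t i : ℝ) : AddCircle (1 : ℝ))] at h2
      linarith
    have hfar' : ∀ i, α / 2 < |z - t i| := by
      intro i
      refine (hfar i).trans_le ?_
      rw [dist_eq_norm, ← AddCircle.coe_sub]
      exact hle _
    have hall : ∀ i, t i ≤ z := by
      intro i
      induction i using Fin.induction with
      | zero => exact hz.1
      | succ i ih =>
        by_contra! hlt
        have h1 := hfar' i.castSucc
        have h2 := hfar' i.succ
        rw [abs_of_nonneg (by linarith)] at h1
        rw [abs_of_neg (by linarith)] at h2
        linarith [hgap i]
    have h1 := hfar' (Fin.last n)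
    rw [abs_of_nonneg (by linarith [hall (Fin.last n)])] at h1
    have h2 : α / 2 < |z - (t 0 + 1)| := by
      refine (hfar 0).trans_le ?_
      have h3 := hle (z - (t 0 + 1))
      rwa [AddCircle.coe_sub, AddCircle.coe_add, AddCircle.coe_period, add_zero,
        ← dist_eq_norm] at h3
    rw [abs_of_neg (by linarith [hz.2])] at h2
    linarith
  · rw [dist_eq_norm, ← AddCircle.coe_sub]
    refine (hle _).trans ?_
    have h1 := hmono (Fin.zero_le i)
    have h2 := hmono (Fin.le_last i)
    rw [abs_le]
    constructor <;> linarith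
end
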